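/- arXiv:1609.03465 — 5 statements merged into one kernel-verified Lean document; each statement's English description precedes it below -/
import Mathlib

section
/- Theorem 1: The F-J model is convergent if and only if Assumption 1 holds. -/
open Matrix Filter Finset

/-- The Friedkin–Johnsen iteration: `x 0 = x0`, `x (k+1) = A ⬝ x k + B ⬝ x0`. -/
noncomputable def fjSeq {n : ℕ} (A B : Matrix (Fin n) (Fin n) ℝ) (x0 : Fin n → ℝ) :
    ℕ → Fin n → ℝ
  | 0 => x0
  | k + 1 => A.mulVec (fjSeq A B x0 k) + B.mulVec x0

/-- `S` is an independent strongly connected component of the influence graph `G(W)`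
(edge from `j` to `i` iff `W i j ≠ 0`): nonempty, in-closed and strongly connected. -/
def IsISCC {n : ℕ} (W : Matrix (Fin n) (Fin n) ℝ) (S : Set (Fin n)) : Prop :=
  S.Nonempty ∧ (∀ i ∈ S, ∀ j, W i j ≠ 0 → j ∈ S) ∧
    (∀ i ∈ S, ∀ j ∈ S, i ≠ j → ∃ m, 1 ≤ m ∧ 0 < (W ^ m) i j)

/-- Assumption 1: every ISCC with more than one element consisting only of non-stubborn
agents contains a vertex with two closed walks of coprime lengths. -/
def Assumption1 {n : ℕ} (W : Matrix (Fin n) (Fin n) ℝ) (ξ : Fin n → ℝ) : Prop :=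
  ∀ S : Set (Fin n), IsISCC W S → S.Nontrivial → (∀ i ∈ S, ξ i = 1) →
    ∃ i ∈ S, ∃ m₁ m₂ : ℕ, 1 ≤ m₁ ∧ 1 ≤ m₂ ∧ Nat.gcd m₁ m₂ = 1 ∧
      0 < (W ^ m₁) i i ∧ 0 < (W ^ m₂) i i

section Nonexpansive

variable {X : Type*} [PseudoMetricSpace X] [ProperSpace X]

/-- A nonexpansive map with a bounded orbit `F^[k] x` has a point `y` whose orbit is bounded, whose
consecutive iterates keep a constant distance, and which attracts the orbit as soon as it is
fixed. -/
theorem LipschitzWith.exists_clusterPt_of_bounded_orbit {F : X → X} (hF : LipschitzWith 1 F)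
    {x : X} (hx : Bornology.IsBounded (Set.range fun k => F^[k] x)) :
    ∃ (y : X) (c B : ℝ), (∀ m, dist (F^[m + 1] y) (F^[m] y) = c) ∧
      (∀ m, dist (F^[m] y) x ≤ B) ∧
      (F y = y → Tendsto (fun k => F^[k] x) atTop (nhds y)) := by
  have hdist : ∀ m a b, dist (F^[m] a) (F^[m] b) ≤ dist a b := fun m a b => by
    simpa using (hF.iterate m).dist_le_mul a b
  obtain ⟨y, -, φ, hφ, hy⟩ := tendsto_subseq_of_bounded hx (fun k => Set.mem_range_self k)
  have hanti : Antitone fun k => dist (F^[k + 1] x) (F^[k] x) := antitone_nat_of_succ_le fun k => by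
    simpa [Function.iterate_succ_apply'] using hdist 1 (F^[k + 1] x) (F^[k] x)
  obtain ⟨c, hc⟩ : ∃ c, Tendsto (fun k => dist (F^[k + 1] x) (F^[k] x)) atTop (nhds c) :=
    ⟨_, tendsto_atTop_ciInf hanti ⟨0, by rintro _ ⟨k, rfl⟩; exact dist_nonneg⟩⟩
  have hlim : ∀ m, Tendsto (fun k => F^[m + φ k] x) atTop (nhds (F^[m] y)) := fun m => by
    simpa only [Function.iterate_add_apply, Function.comp_def] using
      ((hF.continuous.iterate m).tendsto y).comp hy
  obtain ⟨C, hC⟩ := Metric.isBounded_iff.mp hx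
  refine ⟨y, c, dist y x + C, fun m => ?_, fun m => ?_, fun hfix => ?_⟩
  · have h1 := (hlim (m + 1)).dist (hlim m)
    have h2 : Tendsto (fun k => m + φ k) atTop atTop :=
      tendsto_atTop_mono (fun k => Nat.le_add_left _ _) hφ.tendsto_atTop
    refine tendsto_nhds_unique h1 ((hc.comp h2).congr fun k => ?_)
    simp only [Function.comp_apply]
    rw [add_right_comm]
  · exact (dist_triangle _ (F^[m] x) _).trans
      (add_le_add (hdist m y x) (hC ⟨m, rfl⟩ ⟨0, rfl⟩))
  · have hfix' : ∀ m, F^[m] y = y := fun m => Function.iterate_fixed hfix m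
    rw [Metric.tendsto_atTop]
    intro ε hε
    obtain ⟨K, hK⟩ := (Metric.tendsto_atTop.mp hy) ε hε
    refine ⟨φ K, fun k hk => ?_⟩
    obtain ⟨m, rfl⟩ := Nat.exists_eq_add_of_le' hk
    calc dist (F^[m + φ K] x) y = dist (F^[m] (F^[φ K] x)) (F^[m] y) := by
          rw [hfix', Function.iterate_add_apply]
      _ ≤ dist (F^[φ K] x) y := hdist _ _ _
      _ < ε := hK K le_rfl

end Nonexpansive

namespace FJ

variable {n : ℕ} {W : Matrix (Fin n) (Fin n) ℝ} {ξ : Fin n → ℝ} {S : Set (Fin n)}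

theorem pow_apply_pos_add (hW0 : ∀ i j, 0 ≤ W i j) {a b : ℕ} {i j l : Fin n}
    (h1 : 0 < (W ^ a) i j) (h2 : 0 < (W ^ b) j l) : 0 < (W ^ (a + b)) i l := by
  rw [pow_add, Matrix.mul_apply]
  exact Finset.sum_pos' (fun p _ => mul_nonneg (Matrix.pow_apply_nonneg hW0 a i p)
    (Matrix.pow_apply_nonneg hW0 b p l)) ⟨j, Finset.mem_univ j, mul_pos h1 h2⟩

theorem pow_apply_self_pos_mul (hW0 : ∀ i j, 0 ≤ W i j) {a : ℕ} {i : Fin n}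
    (h : 0 < (W ^ a) i i) (q : ℕ) : 0 < (W ^ (q * a)) i i := by
  induction q with
  | zero => simp
  | succ q ih => rw [Nat.succ_mul]; exact pow_apply_pos_add hW0 ih h

theorem mem_of_pow_apply_ne_zero (hS : ∀ i ∈ S, ∀ j, W i j ≠ 0 → j ∈ S) {i j : Fin n} {m : ℕ}
    (hi : i ∈ S) (h : (W ^ m) i j ≠ 0) : j ∈ S := by
  induction m generalizing i with
  | zero =>
    rw [pow_zero, Matrix.one_apply] at h
    split_ifs at h with hij
    · exact hij ▸ hi
    · exact absurd rfl h
  | succ m ih =>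
    rw [pow_succ', Matrix.mul_apply] at h
    obtain ⟨l, -, hl⟩ := Finset.exists_ne_zero_of_sum_ne_zero h
    exact ih (hS i hi l (left_ne_zero_of_mul hl)) (right_ne_zero_of_mul hl)

theorem sum_pow_apply (hW1 : ∀ i, ∑ j, W i j = 1) (m : ℕ) (i : Fin n) :
    ∑ j, (W ^ m) i j = 1 := by
  induction m generalizing i with
  | zero => simp [Matrix.one_apply]
  | succ m ih =>
    simp_rw [pow_succ', Matrix.mul_apply]
    rw [Finset.sum_comm]
    simp_rw [← Finset.mul_sum, ih, mul_one, hW1]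

/-- From every vertex an ISCC can be reached along edges traversed backwards. -/
theorem exists_isISCC_reachable (hW0 : ∀ i j, 0 ≤ W i j) (i₀ : Fin n) :
    ∃ S, IsISCC W S ∧ ∀ j ∈ S, ∃ m, 0 < (W ^ m) i₀ j := by
  let R : Fin n → Set (Fin n) := fun i => {j | ∃ m, 0 < (W ^ m) i j}
  let P : Set (Fin n) → Prop := fun S => S.Nonempty ∧ ∀ i ∈ S, ∀ j, W i j ≠ 0 → j ∈ S
  have hR : ∀ i, P (R i) := fun i => ⟨⟨i, 0, by simp⟩, fun j ⟨m, hm⟩ l hl =>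
    ⟨m + 1, pow_apply_pos_add hW0 hm (by simpa using (hW0 j l).lt_of_ne' hl)⟩⟩
  obtain ⟨S, hSR, hS⟩ := exists_minimal_le_of_wellFoundedLT P (R i₀) (hR i₀)
  refine ⟨S, ⟨hS.prop.1, hS.prop.2, fun i hi j hj hij => ?_⟩, fun j hj => hSR hj⟩
  have hsub : R i ≤ S := fun l ⟨m, hm⟩ => mem_of_pow_apply_ne_zero hS.prop.2 hi hm.ne'
  obtain ⟨m, hm⟩ := hS.le_of_le (hR i) hsub hj
  refine ⟨m, Nat.one_le_iff_ne_zero.mpr ?_, hm⟩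
  rintro rfl
  simp [hij] at hm

theorem pow_apply_self_pos_of_coprime (hW0 : ∀ i j, 0 ≤ W i j) {i : Fin n} {a b : ℕ}
    (hab : Nat.gcd a b = 1) (ha : 0 < (W ^ a) i i) (hb : 0 < (W ^ b) i i) :
    ∃ N, ∀ m ≥ N, 0 < (W ^ m) i i := by
  refine ⟨(a - 1) * (b - 1), fun m hm => ?_⟩
  obtain ⟨p, q, rfl⟩ :=
    Nat.exists_add_mul_eq_of_gcd_dvd_of_mul_pred_le a b m (by simp [hab]) hm
  exact pow_apply_pos_add hW0 (pow_apply_self_pos_mul hW0 ha p) (pow_apply_self_pos_mul hW0 hb q)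

/-- An ISCC of non-stubborn agents contains an agent with closed walks of all large lengths. -/
theorem exists_pow_apply_self_pos (hW0 : ∀ i j, 0 ≤ W i j) (hW1 : ∀ i, ∑ j, W i j = 1)
    (hA : Assumption1 W ξ) (hS : IsISCC W S) (hξS : ∀ i ∈ S, ξ i = 1) :
    ∃ i ∈ S, ∃ N, ∀ m ≥ N, 0 < (W ^ m) i i := by
  rcases S.subsingleton_or_nontrivial with hs | hs
  · obtain ⟨i, hi⟩ := hS.1
    refine ⟨i, hi, 0, fun m _ => ?_⟩
    obtain ⟨j, hj⟩ : ∃ j, (W ^ m) i j ≠ 0 := by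
      by_contra! h
      simpa [h] using sum_pow_apply hW1 m i
    obtain rfl := hs hi (mem_of_pow_apply_ne_zero hS.2.1 hi hj)
    exact (Matrix.pow_apply_nonneg hW0 m i i).lt_of_ne' hj
  · obtain ⟨i, hi, a, b, -, -, hab, ha, hb⟩ := hA S hS hs hξS
    exact ⟨i, hi, pow_apply_self_pos_of_coprime hW0 hab ha hb⟩

/-- Every agent reaches all agents of a non-stubborn ISCC by walks of one common length. -/
theorem exists_common_length (hW0 : ∀ i j, 0 ≤ W i j) (hW1 : ∀ i, ∑ j, W i j = 1)
    (hA : Assumption1 W ξ) (hS : IsISCC W S) (hξS : ∀ i ∈ S, ξ i = 1) {i₀ : Fin n}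
    (hi₀ : ∀ j ∈ S, ∃ m, 0 < (W ^ m) i₀ j) :
    ∃ N, ∀ j ∈ S, 0 < (W ^ N) i₀ j := by
  obtain ⟨i, hi, N, hN⟩ := exists_pow_apply_self_pos hW0 hW1 hA hS hξS
  obtain ⟨p, hp⟩ := hi₀ i hi
  have hreach : ∀ j, ∃ m, j ∈ S → 0 < (W ^ m) i j := fun j => by
    by_cases hj : j ∈ S
    · by_cases hij : i = j
      · exact ⟨0, fun _ => by simp [hij]⟩
      · obtain ⟨m, -, hm⟩ := hS.2.2 i hi j hj hij
        exact ⟨m, fun _ => hm⟩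
    · exact ⟨0, fun h => absurd h hj⟩
  choose m hm using hreach
  refine ⟨p + (N + ∑ j, m j), fun j hj => ?_⟩
  have hle : m j ≤ ∑ j, m j := Finset.single_le_sum (fun _ _ => Nat.zero_le _) (Finset.mem_univ j)
  have hsplit : N + ∑ j, m j = (N + (∑ j, m j - m j)) + m j := by omega
  rw [hsplit]
  exact pow_apply_pos_add hW0 hp (pow_apply_pos_add hW0 (hN _ (Nat.le_add_right _ _)) (hm j hj))

section MaximumPrinciple

variable {v : ℕ → Fin n → ℝ} {c : ℝ}

theorem eq_of_attains_max (hW0 : ∀ i j, 0 ≤ W i j) (hW1 : ∀ i, ∑ j, W i j = 1)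
    (hξ : ∀ i, 0 ≤ ξ i ∧ ξ i ≤ 1) {u : Fin n → ℝ} (hu : ∀ i, u i ≤ c) (hc : 0 < c) {i : Fin n}
    (h : ξ i * ∑ j, W i j * u j = c) : ξ i = 1 ∧ ∀ j, 0 < W i j → u j = c := by
  have hle : ∑ j, W i j * u j ≤ c := by
    calc ∑ j, W i j * u j ≤ ∑ j, W i j * c :=
          Finset.sum_le_sum fun j _ => mul_le_mul_of_nonneg_left (hu j) (hW0 i j)
      _ = c := by rw [← Finset.sum_mul, hW1, one_mul]
  have hξi : ξ i = 1 := by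
    refine le_antisymm (hξ i).2 ?_
    nlinarith [mul_le_mul_of_nonneg_left hle (hξ i).1]
  refine ⟨hξi, fun j hj => ?_⟩
  rw [hξi, one_mul] at h
  have hsum : ∑ j, W i j * (c - u j) = 0 := by
    simp_rw [mul_sub, Finset.sum_sub_distrib, ← Finset.sum_mul, hW1, h, one_mul, sub_self]
  have := (Finset.sum_eq_zero_iff_of_nonneg fun j _ =>
    mul_nonneg (hW0 i j) (sub_nonneg.mpr (hu j))).mp hsum j (Finset.mem_univ j)
  rcases mul_eq_zero.mp this with h0 | h0
  · exact absurd h0 hj.ne'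
  · linarith

theorem eq_of_attains_max_of_walk (hW0 : ∀ i j, 0 ≤ W i j) (hW1 : ∀ i, ∑ j, W i j = 1)
    (hξ : ∀ i, 0 ≤ ξ i ∧ ξ i ≤ 1) (hv : ∀ k i, v (k + 1) i = ξ i * ∑ j, W i j * v k j)
    (hvc : ∀ k i, v k i ≤ c) (hc : 0 < c) {m t : ℕ} {i j : Fin n}
    (h : v (t + m) i = c) (hm : 0 < (W ^ m) i j) : v t j = c := by
  induction m generalizing i with
  | zero =>
    rw [pow_zero, Matrix.one_apply] at hm
    split_ifs at hm with hij
    · exact hij ▸ h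
    · exact absurd hm (lt_irrefl _)
  | succ m ih =>
    rw [pow_succ', Matrix.mul_apply] at hm
    obtain ⟨l, -, hl⟩ := Finset.exists_ne_zero_of_sum_ne_zero hm.ne'
    rw [← add_assoc, hv] at h
    exact ih ((eq_of_attains_max hW0 hW1 hξ (hvc _) hc h).2 l
        ((hW0 i l).lt_of_ne' (left_ne_zero_of_mul hl)))
      ((Matrix.pow_apply_nonneg hW0 m l j).lt_of_ne' (right_ne_zero_of_mul hl))

/-- If a trajectory of the homogeneous dynamics attains its positive upper bound late enough, then
some coordinate is eventually constantly equal to that bound. -/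
theorem exists_forall_eq_of_attains_max (hW0 : ∀ i j, 0 ≤ W i j) (hW1 : ∀ i, ∑ j, W i j = 1)
    (hξ : ∀ i, 0 ≤ ξ i ∧ ξ i ≤ 1) (hA : Assumption1 W ξ) (i : Fin n) :
    ∃ N, ∀ (v : ℕ → Fin n → ℝ) (c : ℝ), (∀ k i, v (k + 1) i = ξ i * ∑ j, W i j * v k j) →
      (∀ k i, v k i ≤ c) → 0 < c → ∀ k ≥ N, v k i = c →
      ∃ t j, ∀ r, v (t + r) j = c := by
  obtain ⟨S, hS, hreach⟩ := exists_isISCC_reachable hW0 i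
  by_cases hξS : ∀ j ∈ S, ξ j = 1
  swap
  · push Not at hξS
    obtain ⟨j, hj, hξj⟩ := hξS
    obtain ⟨m, hm⟩ := hreach j hj
    refine ⟨m + 1, fun v c hv hvc hc k hk hki => absurd ?_ hξj⟩
    obtain ⟨t, rfl⟩ := Nat.exists_eq_add_of_le' hk
    have := eq_of_attains_max_of_walk (t := t + 1) hW0 hW1 hξ hv hvc hc
      (by rwa [add_assoc, add_comm 1 m]) hm
    rw [hv] at this
    exact (eq_of_attains_max hW0 hW1 hξ (hvc _) hc this).1
  · obtain ⟨N, hN⟩ := exists_common_length hW0 hW1 hA hS hξS hreach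
    refine ⟨N, fun v c hv hvc hc k hk hki => ?_⟩
    obtain ⟨t, rfl⟩ := Nat.exists_eq_add_of_le' hk
    have hconst : ∀ r, ∀ j ∈ S, v (t + r) j = c := fun r => by
      induction r with
      | zero => exact fun j hj => eq_of_attains_max_of_walk hW0 hW1 hξ hv hvc hc hki (hN j hj)
      | succ r ih =>
        intro j hj
        have hterm : ∀ l, W j l * v (t + r) l = W j l * c := fun l => by
          by_cases hl : W j l = 0
          · simp [hl]
          · rw [ih l (hS.2.1 j hj l hl)]
        rw [← add_assoc, hv, hξS j hj]
        simp_rw [hterm, ← Finset.sum_mul, hW1, one_mul]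
    obtain ⟨j, hj⟩ := hS.1
    exact ⟨t, j, fun r => hconst r j hj⟩

theorem norm_nonpos_of_bounded_sums (hW0 : ∀ i j, 0 ≤ W i j) (hW1 : ∀ i, ∑ j, W i j = 1)
    (hξ : ∀ i, 0 ≤ ξ i ∧ ξ i ≤ 1) (hA : Assumption1 W ξ) {z : ℕ → Fin n → ℝ} {B : ℝ}
    (hz : ∀ k i, z (k + 2) i - z (k + 1) i = ξ i * ∑ j, W i j * (z (k + 1) j - z k j))
    (hB : ∀ k i, |z k i| ≤ B) (hc : ∀ k, ‖z (k + 1) - z k‖ = c) : c ≤ 0 := by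
  by_contra! hpos
  choose N hN using exists_forall_eq_of_attains_max hW0 hW1 hξ hA
  have hbound : ∀ k i, |z (k + 1) i - z k i| ≤ c := fun k i => by
    simpa [hc] using norm_le_pi_norm (z (k + 1) - z k) i
  have hsum : ∀ w : ℕ → Fin n → ℝ, (∀ k i, |w k i| ≤ B) → ∀ t j,
      ¬ ∀ r, w (t + r + 1) j - w (t + r) j = c := fun w hw t j h => by
    have hlin : ∀ r : ℕ, w (t + r) j = w t j + r * c := fun r => by
      induction r with
      | zero => simp
      | succ r ih =>
        have := h r
        rw [← add_assoc]
        push_cast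
        linarith
    obtain ⟨r, hr⟩ := exists_nat_gt (2 * B / c)
    rw [div_lt_iff₀ hpos] at hr
    have h1 := abs_le.mp (hw t j)
    have h2 := abs_le.mp (hw (t + r) j)
    linarith [hlin r]
  let K := ∑ i, N i
  have hNK : ∀ i, N i ≤ K := fun i =>
    Finset.single_le_sum (fun _ _ => Nat.zero_le _) (Finset.mem_univ i)
  obtain ⟨i, hi⟩ : ∃ i, c ≤ |z (K + 1) i - z K i| := by
    by_contra! h
    refine absurd (hc K) (ne_of_lt ((pi_norm_lt_iff hpos).mpr fun i => ?_))
    simpa using h i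
  replace hi := le_antisymm (hbound K i) hi
  rcases abs_choice (z (K + 1) i - z K i) with h | h <;> rw [h] at hi
  · obtain ⟨t, j, htj⟩ := hN i (fun k i => z (k + 1) i - z k i) c hz
      (fun k i => (abs_le.mp (hbound k i)).2) hpos K (hNK i) hi
    exact hsum z hB t j htj
  · obtain ⟨t, j, htj⟩ := hN i (fun k i => -(z (k + 1) i - z k i)) c
      (fun k i => by simp_rw [mul_neg, Finset.sum_neg_distrib, mul_neg]; rw [hz k i])
      (fun k i => by linarith [(abs_le.mp (hbound k i)).1]) hpos K (hNK i) hi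
    refine hsum (fun k i => -z k i) (fun k i => by simpa using hB k i) t j fun r => ?_
    linarith [htj r]

end MaximumPrinciple

/-- One step of the Friedkin–Johnsen iteration with initial opinion `x0`. -/
noncomputable def step (W : Matrix (Fin n) (Fin n) ℝ) (ξ x0 x : Fin n → ℝ) : Fin n → ℝ :=
  fun i => ξ i * ∑ j, W i j * x j + (1 - ξ i) * x0 i

theorem fjSeq_eq_iterate (x0 : Fin n → ℝ) (k : ℕ) :
    fjSeq (Matrix.diagonal ξ * W) (1 - Matrix.diagonal ξ) x0 k = (step W ξ x0)^[k] x0 := by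
  induction k with
  | zero => rfl
  | succ k ih =>
    rw [Function.iterate_succ_apply', ← ih]
    ext i
    simp only [fjSeq, step, Pi.add_apply, ← Matrix.mulVec_mulVec, Matrix.sub_mulVec,
      Matrix.one_mulVec, Pi.sub_apply, Matrix.mulVec_diagonal]
    simp only [Matrix.mulVec, dotProduct]
    ring

theorem step_sub_step (x0 x y : Fin n → ℝ) (i : Fin n) :
    step W ξ x0 x i - step W ξ x0 y i = ξ i * ∑ j, W i j * (x j - y j) := by
  simp only [step, mul_sub, Finset.sum_sub_distrib]
  ring

theorem abs_sum_mul_le (hW0 : ∀ i j, 0 ≤ W i j) (hW1 : ∀ i, ∑ j, W i j = 1) {u : Fin n → ℝ}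
    {B : ℝ} (hu : ∀ j, |u j| ≤ B) (i : Fin n) : |∑ j, W i j * u j| ≤ B := by
  calc |∑ j, W i j * u j| ≤ ∑ j, |W i j * u j| := Finset.abs_sum_le_sum_abs _ _
    _ ≤ ∑ j, W i j * B := Finset.sum_le_sum fun j _ => by
        rw [abs_mul, abs_of_nonneg (hW0 i j)]
        exact mul_le_mul_of_nonneg_left (hu j) (hW0 i j)
    _ = B := by rw [← Finset.sum_mul, hW1, one_mul]

theorem lipschitzWith_step (hW0 : ∀ i j, 0 ≤ W i j) (hW1 : ∀ i, ∑ j, W i j = 1)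
    (hξ : ∀ i, 0 ≤ ξ i ∧ ξ i ≤ 1) (x0 : Fin n → ℝ) : LipschitzWith 1 (step W ξ x0) := by
  refine LipschitzWith.of_dist_le_mul fun x y => ?_
  rw [NNReal.coe_one, one_mul, dist_pi_le_iff dist_nonneg]
  intro i
  rw [Real.dist_eq, step_sub_step, abs_mul, abs_of_nonneg (hξ i).1]
  have := abs_sum_mul_le hW0 hW1 (u := fun j => x j - y j) (fun j => dist_le_pi_dist x y j) i
  exact (mul_le_of_le_one_left (abs_nonneg _) (hξ i).2).trans this

theorem abs_iterate_step_le (hW0 : ∀ i j, 0 ≤ W i j) (hW1 : ∀ i, ∑ j, W i j = 1)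
    (hξ : ∀ i, 0 ≤ ξ i ∧ ξ i ≤ 1) (x0 : Fin n → ℝ) (k : ℕ) (i : Fin n) :
    |(step W ξ x0)^[k] x0 i| ≤ ‖x0‖ := by
  induction k generalizing i with
  | zero => exact norm_le_pi_norm x0 i
  | succ k ih =>
    rw [Function.iterate_succ_apply']
    have h1 := abs_sum_mul_le hW0 hW1 ih i
    have h2 : |x0 i| ≤ ‖x0‖ := norm_le_pi_norm x0 i
    have h3 : 0 ≤ 1 - ξ i := sub_nonneg.mpr (hξ i).2
    calc _ ≤ |ξ i * ∑ j, W i j * (step W ξ x0)^[k] x0 j| + |(1 - ξ i) * x0 i| := abs_add_le _ _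
      _ ≤ ξ i * ‖x0‖ + (1 - ξ i) * ‖x0‖ := by
        rw [abs_mul, abs_mul, abs_of_nonneg (hξ i).1, abs_of_nonneg h3]
        exact add_le_add (mul_le_mul_of_nonneg_left h1 (hξ i).1) (mul_le_mul_of_nonneg_left h2 h3)
      _ = ‖x0‖ := by ring

theorem exists_tendsto_iterate_step (hW0 : ∀ i j, 0 ≤ W i j) (hW1 : ∀ i, ∑ j, W i j = 1)
    (hξ : ∀ i, 0 ≤ ξ i ∧ ξ i ≤ 1) (hA : Assumption1 W ξ) (x0 : Fin n → ℝ) :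
    ∃ L, Tendsto (fun k => (step W ξ x0)^[k] x0) atTop (nhds L) := by
  have hbdd : Bornology.IsBounded (Set.range fun k => (step W ξ x0)^[k] x0) := by
    refine isBounded_iff_forall_norm_le.mpr ⟨‖x0‖, ?_⟩
    rintro _ ⟨k, rfl⟩
    exact (pi_norm_le_iff_of_nonneg (norm_nonneg _)).mpr (abs_iterate_step_le hW0 hW1 hξ x0 k)
  obtain ⟨y, c, B, hc, hB, hy⟩ :=
    (lipschitzWith_step hW0 hW1 hξ x0).exists_clusterPt_of_bounded_orbit hbdd
  refine ⟨y, hy (dist_le_zero.mp ?_)⟩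
  refine (hc 0).le.trans (norm_nonpos_of_bounded_sums (z := fun k => (step W ξ x0)^[k] y)
    (B := B + ‖x0‖) hW0 hW1 hξ hA (fun k i => ?_) (fun k i => ?_) fun k => ?_)
  · simp only [Function.iterate_succ_apply']
    exact step_sub_step _ _ _ i
  · refine (norm_le_pi_norm ((step W ξ x0)^[k] y) i).trans ?_
    have := norm_le_norm_add_norm_sub' ((step W ξ x0)^[k] y) x0
    rw [← dist_eq_norm] at this
    linarith [hB k]
  · rw [← dist_eq_norm]
    exact hc k

theorem iterate_step_single (hS : ∀ i ∈ S, ∀ j, W i j ≠ 0 → j ∈ S) (hξS : ∀ i ∈ S, ξ i = 1)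
    (i : Fin n) (k : ℕ) {j : Fin n} (hj : j ∈ S) :
    (step W ξ (Pi.single i 1))^[k] (Pi.single i 1) j = (W ^ k) j i := by
  induction k generalizing j with
  | zero => simp [Pi.single_apply, Matrix.one_apply]
  | succ k ih =>
    rw [Function.iterate_succ_apply', pow_succ', Matrix.mul_apply, step, hξS j hj, one_mul,
      sub_self, zero_mul, add_zero]
    refine Finset.sum_congr rfl fun l _ => ?_
    by_cases hl : W j l = 0
    · simp [hl]
    · rw [ih (hS j hj l hl)]

theorem assumption1_of_tendsto (hW0 : ∀ i j, 0 ≤ W i j) (hW1 : ∀ i, ∑ j, W i j = 1)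
    (h : ∀ x0 : Fin n → ℝ, ∃ L : Fin n → ℝ, ∀ i,
      Tendsto (fun k => (step W ξ x0)^[k] x0 i) atTop (nhds (L i))) : Assumption1 W ξ := by
  intro S hS _ hξS
  obtain ⟨j, hj⟩ := hS.1
  have hlim : ∀ i, ∃ l, Tendsto (fun k => (W ^ k) j i) atTop (nhds l) := fun i => by
    obtain ⟨L, hL⟩ := h (Pi.single i 1)
    exact ⟨L j, (hL j).congr fun k => iterate_step_single hS.2.1 hξS i k hj⟩
  choose l hl using hlim
  have hsum : ∑ i, l i = 1 :=
    tendsto_nhds_unique (tendsto_finsetSum _ fun i _ => hl i)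
      (by simp_rw [sum_pow_apply hW1]; exact tendsto_const_nhds)
  obtain ⟨i, -, hi⟩ : ∃ i ∈ Finset.univ, 0 < l i :=
    Finset.exists_lt_of_sum_lt (by simp [hsum])
  obtain ⟨K, hK⟩ := eventually_atTop.mp ((hl i).eventually_const_lt hi)
  have hiS : i ∈ S := mem_of_pow_apply_ne_zero hS.2.1 hj (hK K le_rfl).ne'
  obtain ⟨m, hm⟩ : ∃ m, 0 < (W ^ m) i j := by
    by_cases hij : i = j
    · exact ⟨0, by simp [hij]⟩
    · obtain ⟨m, -, hm⟩ := hS.2.2 i hiS j hj hij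
      exact ⟨m, hm⟩
  have hpos : ∀ k ≥ K, 0 < (W ^ (m + k)) i i := fun k hk => pow_apply_pos_add hW0 hm (hK k hk)
  exact ⟨i, hiS, m + (K + 1), m + (K + 1) + 1, by omega, by omega, by simp,
    hpos (K + 1) (by omega), hpos (K + 2) (by omega)⟩

end FJ

/-- Theorem 1: the F-J model is convergent iff Assumption 1 holds. -/
theorem fj_convergent_iff_assumption1
    (n : ℕ) (hn : 1 ≤ n)
    (W Ξ : Matrix (Fin n) (Fin n) ℝ) (ξ : Fin n → ℝ)
    (hW0 : ∀ i j, 0 ≤ W i j) (hW1 : ∀ i, ∑ j, W i j = 1)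
    (hΞ : Ξ = Matrix.diagonal ξ) (hξ : ∀ i, 0 ≤ ξ i ∧ ξ i ≤ 1) :
    (∀ x0 : Fin n → ℝ, ∃ L : Fin n → ℝ, ∀ i,
        Tendsto (fun k => fjSeq (Ξ * W) (1 - Ξ) x0 k i) atTop (nhds (L i)))
    ↔ Assumption1 W ξ := by
  subst hΞ
  simp_rw [FJ.fjSeq_eq_iterate]
  refine ⟨FJ.assumption1_of_tendsto hW0 hW1, fun hA x0 => ?_⟩
  obtain ⟨L, hL⟩ := FJ.exists_tendsto_iterate_step hW0 hW1 hξ hA x0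
  exact ⟨L, tendsto_pi_nhds.mp hL⟩
end

section
/- Under Assumption 2, the matrix I − ΞW is invertible and the matrix Ψ = (I − ΞW)⁻¹(I − Ξ) is row-stochastic: entrywise nonnegative with every row sum equal to 1. -/
open Matrix Filter Finset

/-- Assumption 2: every ISCC of `G(W)` contains at least one stubborn agent. -/
def Assumption2 {n : ℕ} (W : Matrix (Fin n) (Fin n) ℝ) (ξ : Fin n → ℝ) : Prop :=
  ∀ S : Set (Fin n), IsISCC W S → ∃ i ∈ S, ξ i < 1

/-- Every nonempty in-closed set contains an independent strongly connected component. -/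
lemma exists_isISCC_subset {n : ℕ} {W : Matrix (Fin n) (Fin n) ℝ}
    (hW0 : ∀ i j, 0 ≤ W i j) (hW1 : ∀ i, ∑ j, W i j = 1) {T : Set (Fin n)}
    (hT : T.Nonempty) (hTc : ∀ i ∈ T, ∀ j, W i j ≠ 0 → j ∈ T) :
    ∃ S ⊆ T, IsISCC W S := by
  obtain ⟨S, hST, hS⟩ :=
    (Set.toFinite {S : Set (Fin n) | S.Nonempty ∧ ∀ i ∈ S, ∀ j, W i j ≠ 0 → j ∈ S}).exists_le_minimal
      (a := T) ⟨hT, hTc⟩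
  have hSc := hS.prop.2
  refine ⟨S, hST, hS.prop.1, hSc, fun i hi j hj _ => ?_⟩
  have hsub : S ⊆ {j | j ∈ S ∧ ∃ m, 1 ≤ m ∧ 0 < (W ^ m) i j} := by
    refine hS.le_of_le ⟨?_, ?_⟩ fun k hk => hk.1
    · obtain ⟨k, -, hk⟩ : ∃ k ∈ Finset.univ, W i k ≠ 0 :=
        Finset.exists_ne_zero_of_sum_ne_zero (by rw [hW1 i]; exact one_ne_zero)
      exact ⟨k, hSc i hi k hk, 1, le_rfl, by simpa using (hW0 i k).lt_of_ne' hk⟩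
    · rintro j ⟨hj, m, hm, hpos⟩ k hk
      refine ⟨hSc j hj k hk, m + 1, by omega, ?_⟩
      rw [pow_succ, Matrix.mul_apply]
      exact Finset.sum_pos'
        (fun l _ => mul_nonneg (Matrix.pow_apply_nonneg hW0 m i l) (hW0 l k))
        ⟨j, Finset.mem_univ j, mul_pos hpos ((hW0 j k).lt_of_ne' hk)⟩
  exact (hsub hj).2

/-- Under Assumption 2, `I - ΞW` is inverse-positive: `ΞW x ≤ x` forces `0 ≤ x`. -/
lemma nonneg_of_mul_mulVec_le {n : ℕ} {W : Matrix (Fin n) (Fin n) ℝ} {ξ : Fin n → ℝ}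
    (hW0 : ∀ i j, 0 ≤ W i j) (hW1 : ∀ i, ∑ j, W i j = 1) (hξ : ∀ i, 0 ≤ ξ i ∧ ξ i ≤ 1)
    (hA2 : Assumption2 W ξ) {x : Fin n → ℝ} (hx : ∀ i, ξ i * ∑ j, W i j * x j ≤ x i)
    (i : Fin n) : 0 ≤ x i := by
  by_contra! hi
  have : Nonempty (Fin n) := ⟨i⟩
  obtain ⟨k, hk⟩ := Finite.exists_min x
  have hk0 : x k < 0 := (hk i).trans_lt hi
  have havg : ∀ i, x k ≤ ∑ j, W i j * x j := fun i => by
    calc x k = ∑ j, W i j * x k := by rw [← Finset.sum_mul, hW1, one_mul]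
      _ ≤ _ := Finset.sum_le_sum fun j _ => mul_le_mul_of_nonneg_left (hk j) (hW0 i j)
  have hone : ∀ i, x i = x k → ξ i = 1 := fun i hik => by
    have h := hx i
    have h' := mul_le_mul_of_nonneg_left (havg i) (hξ i).1
    refine le_antisymm (hξ i).2 ?_
    by_contra! hlt
    nlinarith
  obtain ⟨S, hS, hSI⟩ := exists_isISCC_subset hW0 hW1 (T := {i | x i = x k}) ⟨k, rfl⟩ (by
    intro i hik j hij
    have h := hx i
    rw [hone i hik, one_mul, hik] at h
    have hsum : ∑ j, W i j * (x j - x k) = 0 := by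
      simp_rw [mul_sub]
      rw [Finset.sum_sub_distrib, ← Finset.sum_mul, hW1, one_mul]
      linarith [havg i]
    have hj := (Finset.sum_eq_zero_iff_of_nonneg fun j _ =>
      mul_nonneg (hW0 i j) (sub_nonneg.2 (hk j))).1 hsum j (Finset.mem_univ j)
    exact sub_eq_zero.1 ((mul_eq_zero.1 hj).resolve_left hij))
  obtain ⟨j, hj, hlt⟩ := hA2 S hSI
  exact hlt.ne (hone j (hS hj))

/-- Under Assumption 2, `I - ΞW` is invertible and `Ψ = (I - ΞW)⁻¹ (I - Ξ)`
is row-stochastic. -/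
theorem psi_row_stochastic_of_assumption2
    (n : ℕ) (hn : 1 ≤ n)
    (W Ξ : Matrix (Fin n) (Fin n) ℝ) (ξ : Fin n → ℝ)
    (hW0 : ∀ i j, 0 ≤ W i j) (hW1 : ∀ i, ∑ j, W i j = 1)
    (hΞ : Ξ = Matrix.diagonal ξ) (hξ : ∀ i, 0 ≤ ξ i ∧ ξ i ≤ 1)
    (hA2 : Assumption2 W ξ) :
    IsUnit (1 - Ξ * W) ∧
    (∀ i j, 0 ≤ ((1 - Ξ * W)⁻¹ * (1 - Ξ)) i j) ∧
    (∀ i, ∑ j, ((1 - Ξ * W)⁻¹ * (1 - Ξ)) i j = 1) := by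
  subst hΞ
  set A := 1 - Matrix.diagonal ξ * W with hA
  have hAv : ∀ x i, (A *ᵥ x) i = x i - ξ i * ∑ j, W i j * x j := fun x i => by
    rw [hA, Matrix.sub_mulVec, Matrix.one_mulVec, ← Matrix.mulVec_mulVec, Pi.sub_apply,
      Matrix.mulVec_diagonal]
    rfl
  have hpos : ∀ x, (∀ i, 0 ≤ (A *ᵥ x) i) → ∀ i, 0 ≤ x i := fun x hx =>
    nonneg_of_mul_mulVec_le hW0 hW1 hξ hA2 fun i => sub_nonneg.1 (hAv x i ▸ hx i)
  have hdet : IsUnit A.det := by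
    rw [isUnit_iff_ne_zero]
    intro h
    obtain ⟨v, hv, hAv0⟩ := Matrix.exists_mulVec_eq_zero_iff.2 h
    refine hv (funext fun i => le_antisymm ?_ (hpos v (by simp [hAv0]) i))
    simpa using hpos (-v) (by simp [Matrix.mulVec_neg, hAv0]) i
  refine ⟨(Matrix.isUnit_iff_isUnit_det A).2 hdet, fun i j => ?_, fun i => ?_⟩
  · refine hpos (fun i => (A⁻¹ * (1 - Matrix.diagonal ξ)) i j) (fun i => ?_) i
    change 0 ≤ (A * (A⁻¹ * (1 - Matrix.diagonal ξ))) i j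
    rw [Matrix.mul_nonsing_inv_cancel_left _ _ hdet, Matrix.sub_apply, Matrix.one_apply,
      Matrix.diagonal_apply]
    split_ifs
    · exact sub_nonneg.2 (hξ i).2
    · simp
  · have hAone : (1 - Matrix.diagonal ξ) *ᵥ (1 : Fin n → ℝ) = A *ᵥ 1 := by
      funext i
      rw [hAv, Matrix.sub_mulVec, Matrix.one_mulVec, Pi.sub_apply, Matrix.mulVec_diagonal]
      simp [hW1]
    have h : (A⁻¹ * (1 - Matrix.diagonal ξ)) *ᵥ (1 : Fin n → ℝ) = 1 := by
      rw [← Matrix.mulVec_mulVec, hAone, Matrix.mulVec_mulVec, Matrix.nonsing_inv_mul _ hdet,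
        Matrix.one_mulVec]
    simpa [Matrix.mulVec, dotProduct] using congrFun h i
end

section
/- Property 2: Suppose Assumption 1 holds, so the F-J model is convergent; let Ψ = lim_{k→∞} Ψ(k), where Ψ(k) = (ΞW)^k + Σ_{t=0}^{k−1} (ΞW)^t (I − Ξ). If i is non-stubborn (ξᵢ = 1) and there exists a stubborn agent j (ξⱼ < 1) with a directed path from j to i in G(W) (i.e., (W^m) i j > 0 for some m ≥ 1), then the i-th column of Ψ is zero: Ψ l i = 0 for every l ∈ V. -/
open Matrix Filter Finset

/-- `Ψ(k) = A^k + ∑_{t=0}^{k-1} A^t E`, with `A = ΞW` and `E = I - Ξ`. -/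
noncomputable def psiK {n : ℕ} (A E : Matrix (Fin n) (Fin n) ℝ) (k : ℕ) :
    Matrix (Fin n) (Fin n) ℝ :=
  A ^ k + ∑ t ∈ Finset.range k, A ^ t * E

theorem matrix_pow_nonneg {n : ℕ} {A : Matrix (Fin n) (Fin n) ℝ} (hA : ∀ i j, 0 ≤ A i j)
    (k : ℕ) (i j : Fin n) : 0 ≤ (A ^ k) i j := by
  induction k generalizing i j with
  | zero =>
    rw [pow_zero, Matrix.one_apply]
    split_ifs <;> norm_num
  | succ k ih =>
    rw [pow_succ, Matrix.mul_apply]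
    exact Finset.sum_nonneg fun a _ => mul_nonneg (ih i a) (hA a j)

/-- If `i` reaches a stubborn vertex along the walks of `W`, then it reaches one along the walks
of `diagonal ξ * W`. -/
theorem exists_pow_diagonal_mul_pos {n : ℕ} {W : Matrix (Fin n) (Fin n) ℝ} {ξ : Fin n → ℝ}
    (hW : ∀ i j, 0 ≤ W i j) (hξ : ∀ i, 0 ≤ ξ i) {m : ℕ} {i j : Fin n} (hj : ξ j < 1)
    (h : 0 < (W ^ m) i j) :
    ∃ m' j', ξ j' < 1 ∧ 0 < ((Matrix.diagonal ξ * W) ^ m') i j' := by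
  have hA : ∀ i j, 0 ≤ (Matrix.diagonal ξ * W) i j := fun i j => by
    rw [Matrix.diagonal_mul]
    exact mul_nonneg (hξ i) (hW i j)
  induction m generalizing i with
  | zero =>
    refine ⟨0, j, hj, ?_⟩
    simpa using h
  | succ m ih =>
    rcases lt_or_ge (ξ i) 1 with hi | hi
    · exact ⟨0, i, hi, by simp⟩
    rw [pow_succ', Matrix.mul_apply] at h
    obtain ⟨a, -, ha⟩ := Finset.exists_lt_of_sum_lt (s := Finset.univ)
      (f := fun _ : Fin n => (0 : ℝ)) (by simpa using h)
    have hWa : 0 < W i a := pos_of_mul_pos_left ha (matrix_pow_nonneg hW m a j)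
    obtain ⟨m', j', hj', hpos⟩ := ih (pos_of_mul_pos_right ha (hW i a))
    refine ⟨m' + 1, j', hj', ?_⟩
    rw [pow_succ', Matrix.mul_apply]
    refine Finset.sum_pos' (fun b _ => mul_nonneg (hA i b) (matrix_pow_nonneg hA m' b j'))
      ⟨a, Finset.mem_univ a, mul_pos ?_ hpos⟩
    rw [Matrix.diagonal_mul]
    exact mul_pos (by linarith) hWa

/-- In the powers of a nonnegative matrix with row sums `ξ ≤ 1`, the columns of the vertices with
deficient row sum vanish in the limit. -/
theorem tendsto_pow_apply_zero_of_row_sum_lt_one {n : ℕ} {A : Matrix (Fin n) (Fin n) ℝ}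
    {ξ : Fin n → ℝ} (hA : ∀ i j, 0 ≤ A i j) (hsum : ∀ i, ∑ j, A i j = ξ i) (hξ : ∀ i, ξ i ≤ 1)
    {j : Fin n} (hj : ξ j < 1) (l : Fin n) :
    Tendsto (fun k => (A ^ k) l j) atTop (nhds 0) := by
  have hstep : ∀ k, ∑ a, (A ^ (k + 1)) l a = ∑ a, (A ^ k) l a * ξ a := fun k => by
    simp_rw [pow_succ, Matrix.mul_apply]
    rw [Finset.sum_comm]
    simp_rw [← Finset.mul_sum, hsum]
  have htel : ∀ K, ∑ k ∈ Finset.range K, ∑ a, (A ^ k) l a * (1 - ξ a)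
      = 1 - ∑ a, (A ^ K) l a := fun K => by
    induction K with
    | zero => simp [Matrix.one_apply]
    | succ K ih =>
      rw [Finset.sum_range_succ, ih, hstep]
      simp only [mul_sub, mul_one, Finset.sum_sub_distrib]
      ring
  have hsummable : Summable fun k => (A ^ k) l j * (1 - ξ j) := by
    refine summable_of_sum_range_le (c := 1)
      (fun k => mul_nonneg (matrix_pow_nonneg hA k l j) (by linarith)) fun K => ?_
    calc ∑ k ∈ Finset.range K, (A ^ k) l j * (1 - ξ j)
        ≤ ∑ k ∈ Finset.range K, ∑ a, (A ^ k) l a * (1 - ξ a) :=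
          Finset.sum_le_sum fun k _ => Finset.single_le_sum
            (f := fun a => (A ^ k) l a * (1 - ξ a))
            (fun a _ => mul_nonneg (matrix_pow_nonneg hA k l a) (sub_nonneg.2 (hξ a)))
            (Finset.mem_univ j)
      _ = 1 - ∑ a, (A ^ K) l a := htel K
      _ ≤ 1 := sub_le_self _ (Finset.sum_nonneg fun a _ => matrix_pow_nonneg hA K l a)
  have hne : 1 - ξ j ≠ 0 := by linarith
  simpa [hne] using hsummable.tendsto_atTop_zero.div_const (1 - ξ j)

/-- If the column of `j` vanishes in the limit of the powers of a nonnegative matrix, so does the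
column of every `i` with a walk from `i` to `j`. -/
theorem tendsto_pow_apply_zero_of_pow_pos {n : ℕ} {A : Matrix (Fin n) (Fin n) ℝ}
    (hA : ∀ i j, 0 ≤ A i j) {m : ℕ} {i j l : Fin n} (hpos : 0 < (A ^ m) i j)
    (hj : Tendsto (fun k => (A ^ k) l j) atTop (nhds 0)) :
    Tendsto (fun k => (A ^ k) l i) atTop (nhds 0) := by
  have hbound : Tendsto (fun k => (A ^ (k + m)) l j / (A ^ m) i j) atTop (nhds 0) := by
    simpa using ((tendsto_add_atTop_iff_nat m).2 hj).div_const ((A ^ m) i j)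
  refine squeeze_zero (fun k => matrix_pow_nonneg hA k l i) (fun k => ?_) hbound
  rw [le_div_iff₀ hpos, pow_add, Matrix.mul_apply]
  exact Finset.single_le_sum (f := fun a => (A ^ k) l a * (A ^ m) a j)
    (fun a _ => mul_nonneg (matrix_pow_nonneg hA k l a) (matrix_pow_nonneg hA m a j))
    (Finset.mem_univ i)

/-- Property 2: under Assumption 1, if `i` is non-stubborn and some stubborn agent `j`
has a directed path to `i` in `G(W)`, then the `i`-th column of `Ψ = lim_k Ψ(k)`
is zero. -/
theorem psi_column_zero_of_nonstubborn_reached_by_stubborn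
    (n : ℕ) (hn : 1 ≤ n)
    (W Ξ : Matrix (Fin n) (Fin n) ℝ) (ξ : Fin n → ℝ)
    (hW0 : ∀ i j, 0 ≤ W i j) (hW1 : ∀ i, ∑ j, W i j = 1)
    (hΞ : Ξ = Matrix.diagonal ξ) (hξ : ∀ i, 0 ≤ ξ i ∧ ξ i ≤ 1)
    (hA1 : Assumption1 W ξ)
    (Ψ : Matrix (Fin n) (Fin n) ℝ)
    (hΨ : ∀ i j, Tendsto (fun k => psiK (Ξ * W) (1 - Ξ) k i j) atTop (nhds (Ψ i j)))
    (i : Fin n) (hi : ξ i = 1)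
    (j : Fin n) (hj : ξ j < 1) (hpath : ∃ m, 1 ≤ m ∧ 0 < (W ^ m) i j) :
    ∀ l, Ψ l i = 0 := by
  intro l
  subst hΞ
  obtain ⟨m, -, hm⟩ := hpath
  obtain ⟨m', j', hj', hpos⟩ := exists_pow_diagonal_mul_pos hW0 (fun a => (hξ a).1) hj hm
  have hA : ∀ a b, 0 ≤ (Matrix.diagonal ξ * W) a b := fun a b => by
    rw [Matrix.diagonal_mul]
    exact mul_nonneg (hξ a).1 (hW0 a b)
  have hsum : ∀ a, ∑ b, (Matrix.diagonal ξ * W) a b = ξ a := fun a => by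
    simp_rw [Matrix.diagonal_mul, ← Finset.mul_sum, hW1, mul_one]
  have hE : (1 : Matrix (Fin n) (Fin n) ℝ) - Matrix.diagonal ξ
      = Matrix.diagonal fun a => 1 - ξ a := by
    rw [← Matrix.diagonal_one, Matrix.diagonal_sub]
  have hcol : ∀ k, psiK (Matrix.diagonal ξ * W) (1 - Matrix.diagonal ξ) k l i
      = ((Matrix.diagonal ξ * W) ^ k) l i := fun k => by
    simp [psiK, hE, Matrix.sum_apply, Matrix.mul_diagonal, hi]
  refine tendsto_nhds_unique (hΨ l i) ?_
  simp_rw [hcol]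
  exact tendsto_pow_apply_zero_of_pow_pos hA hpos
    (tendsto_pow_apply_zero_of_row_sum_lt_one hA hsum (fun a => (hξ a).2) hj' l)
end

section
/- Property 3: Under Assumption 2, let Vp = {i ∈ V : 0 < ξᵢ < 1} and let M be the n×n matrix with M a b = Ψ a b when a, b ∈ Vp and M a b = 0 otherwise. If i ∈ Vp is a root of the subgraph G(Ψ_pp), i.e., for every j ∈ Vp with j ≠ i there is m ≥ 1 with (M^m) j i > 0, then i is a center vertex of that subgraph: Ψ j i > 0 for every j ∈ Vp with j ≠ i. -/
open Matrix Filter Finset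

open Topology

/-- Entrywise minimum principle: if `s > 1` exceeds all row sums of a nonnegative matrix `A`, the
resolvent of `A` at `s` is entrywise nonnegative. -/
lemma resolvent_nonneg_of_one_lt {ι : Type*} [Fintype ι] [DecidableEq ι] {A : Matrix ι ι ℝ}
    (hA0 : ∀ i j, 0 ≤ A i j) (hA1 : ∀ i, ∑ j, A i j ≤ 1) {s : ℝ} (hs : 1 < s)
    (hdet : IsUnit (s • (1 : Matrix ι ι ℝ) - A).det) (a c : ι) :
    0 ≤ (s • (1 : Matrix ι ι ℝ) - A)⁻¹ a c := by
  set R := (s • (1 : Matrix ι ι ℝ) - A)⁻¹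
  have hmul : (s • (1 : Matrix ι ι ℝ) - A) * R = 1 := Matrix.mul_nonsing_inv _ hdet
  obtain ⟨i, -, hi⟩ := Finset.exists_min_image Finset.univ (fun k => R k c) ⟨a, Finset.mem_univ a⟩
  refine le_trans ?_ (hi a (Finset.mem_univ a))
  by_contra! hneg
  have hentry : s * R i c - ∑ j, A i j * R j c = (1 : Matrix ι ι ℝ) i c := by
    rw [← hmul, sub_mul]
    simp [Matrix.mul_apply]
  have hone : 0 ≤ (1 : Matrix ι ι ℝ) i c := by
    rw [Matrix.one_apply]
    split_ifs <;> norm_num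
  have hsum : (∑ j, A i j) * R i c ≤ ∑ j, A i j * R j c := by
    rw [Finset.sum_mul]
    exact Finset.sum_le_sum fun j hj => mul_le_mul_of_nonneg_left (hi j hj) (hA0 i j)
  nlinarith [hA1 i]

lemma tendsto_resolvent_one {ι : Type*} [Fintype ι] [DecidableEq ι] {A : Matrix ι ι ℝ}
    (hdet : IsUnit (1 - A).det) :
    (∀ᶠ s : ℝ in 𝓝[>] 1, IsUnit (s • (1 : Matrix ι ι ℝ) - A).det) ∧
      ∀ a b, Tendsto (fun s : ℝ => (s • (1 : Matrix ι ι ℝ) - A)⁻¹ a b) (𝓝[>] 1)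
        (𝓝 ((1 - A)⁻¹ a b)) := by
  have hcont : Continuous fun s : ℝ => s • (1 : Matrix ι ι ℝ) - A := by fun_prop
  have hdet' : Tendsto (fun s : ℝ => (s • (1 : Matrix ι ι ℝ) - A).det) (𝓝[>] 1)
      (𝓝 (1 - A).det) := by
    simpa using (hcont.matrix_det.tendsto 1).mono_left nhdsWithin_le_nhds
  refine ⟨?_, fun a b => ?_⟩
  · filter_upwards [hdet'.eventually_ne hdet.ne_zero] with s hs using hs.isUnit
  · have hadj : Tendsto (fun s : ℝ => (s • (1 : Matrix ι ι ℝ) - A).adjugate a b) (𝓝[>] 1)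
        (𝓝 ((1 - A).adjugate a b)) := by
      simpa using ((hcont.matrix_adjugate.matrix_elem a b).tendsto 1).mono_left nhdsWithin_le_nhds
    simpa [Matrix.inv_def, Ring.inverse_eq_inv'] using (hdet'.inv₀ hdet.ne_zero).mul hadj

section SubstochasticInverse

variable {ι : Type*} [Fintype ι] [DecidableEq ι] {A : Matrix ι ι ℝ}

lemma inv_one_sub_nonneg (hA0 : ∀ i j, 0 ≤ A i j) (hA1 : ∀ i, ∑ j, A i j ≤ 1)
    (hdet : IsUnit (1 - A).det) (a b : ι) : 0 ≤ (1 - A)⁻¹ a b := by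
  obtain ⟨hunit, htend⟩ := tendsto_resolvent_one hdet
  refine ge_of_tendsto (htend a b) ?_
  filter_upwards [hunit, self_mem_nhdsWithin] with s hs hs1
  exact resolvent_nonneg_of_one_lt hA0 hA1 hs1 hs a b

/-- The support of `(1 - A)⁻¹` is a transitive relation, by the resolvent identity. -/
lemma inv_one_sub_pos_trans (hA0 : ∀ i j, 0 ≤ A i j) (hA1 : ∀ i, ∑ j, A i j ≤ 1)
    (hdet : IsUnit (1 - A).det) {a b c : ι} (hab : 0 < (1 - A)⁻¹ a b)
    (hbc : 0 < (1 - A)⁻¹ b c) : 0 < (1 - A)⁻¹ a c := by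
  obtain ⟨hunit, htend⟩ := tendsto_resolvent_one hdet
  obtain ⟨s, hs, hs1, hpos⟩ := (hunit.and (eventually_mem_nhdsWithin.and
    ((htend a b).eventually_const_lt hab))).exists
  have hs1 : 1 < s := hs1
  set T := (s • (1 : Matrix ι ι ℝ) - A)⁻¹
  set R := (1 - A)⁻¹
  have hid : R = T + (s - 1) • (T * R) := by
    have hTmul : T * (s • (1 : Matrix ι ι ℝ) - A) = 1 := Matrix.nonsing_inv_mul _ hs
    have hRmul : (1 - A) * R = 1 := Matrix.mul_nonsing_inv _ hdet
    calc R = T * (s • (1 : Matrix ι ι ℝ) - A) * R := by rw [hTmul, one_mul]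
      _ = T * ((1 - A) + (s - 1) • (1 : Matrix ι ι ℝ)) * R := by
        congr 2
        rw [sub_smul, one_smul]
        abel
      _ = T * ((1 - A) * R) + (s - 1) • (T * R) := by
        simp only [mul_add, add_mul, Matrix.mul_assoc, Matrix.mul_smul, Matrix.smul_mul,
          Matrix.one_mul]
      _ = T + (s - 1) • (T * R) := by rw [hRmul, mul_one]
  have hT0 : ∀ x y, 0 ≤ T x y := resolvent_nonneg_of_one_lt hA0 hA1 hs1 hs
  have hTR : 0 < (T * R) a c := by
    rw [Matrix.mul_apply]
    exact Finset.sum_pos' (fun k _ => mul_nonneg (hT0 a k) (inv_one_sub_nonneg hA0 hA1 hdet k c))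
      ⟨b, Finset.mem_univ b, mul_pos hpos hbc⟩
  rw [hid, Matrix.add_apply, Matrix.smul_apply, smul_eq_mul]
  exact add_pos_of_nonneg_of_pos (hT0 a c) (mul_pos (sub_pos.2 hs1) hTR)

end SubstochasticInverse

/-- A transitive relation containing the support of a nonnegative matrix contains the support of
each of its positive powers. -/
lemma rel_of_pow_pos {ι : Type*} [Fintype ι] [DecidableEq ι] {M : Matrix ι ι ℝ}
    (hM0 : ∀ i j, 0 ≤ M i j) {r : ι → ι → Prop} (hr : ∀ a b c, r a b → r b c → r a c)
    (hMr : ∀ a b, 0 < M a b → r a b) {m : ℕ} (hm : 1 ≤ m) {a b : ι}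
    (hab : 0 < (M ^ m) a b) : r a b := by
  induction m, hm using Nat.le_induction generalizing b with
  | base => exact hMr a b (by simpa using hab)
  | succ m _ ih =>
    rw [pow_succ, Matrix.mul_apply] at hab
    obtain ⟨c, -, hc⟩ : ∃ c ∈ Finset.univ, 0 < (M ^ m) a c * M c b :=
      Finset.exists_lt_of_sum_lt (by simpa using hab)
    have hcb : 0 < M c b := (hM0 c b).lt_of_ne' (right_ne_zero_of_mul hc.ne')
    exact hr a c b (ih (pos_of_mul_pos_left hc (hM0 c b))) (hMr c b hcb)

/-- Property 3: under Assumption 2, any root of the subgraph `G(Ψ_pp)` of `G(Ψ)`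
restricted to the partially stubborn agents is a center vertex of that subgraph. -/
theorem root_of_psi_pp_is_center
    (n : ℕ) (hn : 1 ≤ n)
    (W Ξ : Matrix (Fin n) (Fin n) ℝ) (ξ : Fin n → ℝ)
    (hW0 : ∀ i j, 0 ≤ W i j) (hW1 : ∀ i, ∑ j, W i j = 1)
    (hΞ : Ξ = Matrix.diagonal ξ) (hξ : ∀ i, 0 ≤ ξ i ∧ ξ i ≤ 1)
    (hA2 : Assumption2 W ξ)
    (Ψ : Matrix (Fin n) (Fin n) ℝ) (hΨ : Ψ = (1 - Ξ * W)⁻¹ * (1 - Ξ))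
    (M : Matrix (Fin n) (Fin n) ℝ)
    (hM : ∀ a b, M a b = if 0 < ξ a ∧ ξ a < 1 ∧ 0 < ξ b ∧ ξ b < 1 then Ψ a b else 0)
    (i : Fin n) (hip : 0 < ξ i ∧ ξ i < 1)
    (hroot : ∀ j, 0 < ξ j → ξ j < 1 → j ≠ i → ∃ m, 1 ≤ m ∧ 0 < (M ^ m) j i) :
    ∀ j, 0 < ξ j → ξ j < 1 → j ≠ i → 0 < Ψ j i := by
  intro j hj0 hj1 hji
  obtain ⟨m, hm, hpow⟩ := hroot j hj0 hj1 hji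
  have hA : ∀ a b, (Ξ * W) a b = ξ a * W a b := fun a b => by
    rw [hΞ, Matrix.diagonal_mul]
  have hA0 : ∀ a b, 0 ≤ (Ξ * W) a b := fun a b => by
    rw [hA]
    exact mul_nonneg (hξ a).1 (hW0 a b)
  have hA1 : ∀ a, ∑ b, (Ξ * W) a b ≤ 1 := fun a => by
    simp only [hA, ← Finset.mul_sum, hW1, mul_one]
    exact (hξ a).2
  have hΨR : ∀ a b, Ψ a b = (1 - Ξ * W)⁻¹ a b * (1 - ξ b) := fun a b => by
    rw [hΨ, hΞ, ← Matrix.diagonal_one, Matrix.diagonal_sub, Matrix.mul_diagonal]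
  have hdet : IsUnit (1 - Ξ * W).det := by
    by_contra hdet
    have hM_zero : M = 0 := by
      ext a b
      simp [hM, hΨ, Matrix.nonsing_inv_apply_not_isUnit _ hdet]
    rw [hM_zero, zero_pow (Nat.one_le_iff_ne_zero.1 hm)] at hpow
    exact lt_irrefl _ hpow
  have hM0 : ∀ a b, 0 ≤ M a b := fun a b => by
    rw [hM, hΨR]
    split_ifs
    · exact mul_nonneg (inv_one_sub_nonneg hA0 hA1 hdet a b) (sub_nonneg.2 (hξ b).2)
    · exact le_rfl
  have hMR : ∀ a b, 0 < M a b → 0 < (1 - Ξ * W)⁻¹ a b := fun a b hab => by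
    rw [hM, hΨR] at hab
    split_ifs at hab
    · exact pos_of_mul_pos_left hab (sub_nonneg.2 (hξ b).2)
    · exact absurd hab (lt_irrefl _)
  have hR : 0 < (1 - Ξ * W)⁻¹ j i :=
    rel_of_pow_pos (r := fun a b => 0 < (1 - Ξ * W)⁻¹ a b) hM0
      (fun _ _ _ => inv_one_sub_pos_trans hA0 hA1 hdet) hMR hm hpow
  rw [hΨR]
  exact mul_pos hR (sub_pos.2 hip.2)
end

section
/- Theorem 2: Suppose there are no fully stubborn agents (ξᵢ > 0 for all i ∈ V) and Assumption 2 holds. Then the issue-sequence dynamics x(s+1) = Ψ·x(s) achieves opinion consensus — i.e., for every x(0) ∈ ℝⁿ there exists χ ∈ ℝ with lim_{s→∞} Ψ^s·x(0) = χ·1 — if and only if there exists a partially stubborn agent i (0 < ξᵢ < 1) such that for every other partially stubborn agent j there is m ≥ 1 with (W^m) j i > 0 (a directed path from i to j in G(W)). -/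
open Matrix Filter Finset

/-- No edge of `G(W)` enters `S` from outside. -/
def InClosed {ι : Type*} (W : Matrix ι ι ℝ) (S : Set ι) : Prop :=
  ∀ i ∈ S, ∀ j, W i j ≠ 0 → j ∈ S

/-- The agents with a directed path to `i` in `G(W)`. -/
def influencers {ι : Type*} [Fintype ι] [DecidableEq ι] (W : Matrix ι ι ℝ) (i : ι) : Set ι :=
  {k | ∃ m, 1 ≤ m ∧ 0 < (W ^ m) i k}

section Graph

variable {ι : Type*} [Fintype ι] [DecidableEq ι] {W : Matrix ι ι ℝ}

lemma inClosed_influencers (hW0 : ∀ i j, 0 ≤ W i j) (i : ι) : InClosed W (influencers W i) := by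
  rintro k ⟨m, hm, hk⟩ j hkj
  refine ⟨m + 1, by omega, ?_⟩
  rw [pow_succ, Matrix.mul_apply]
  exact Finset.sum_pos' (fun l _ => mul_nonneg (Matrix.pow_apply_nonneg hW0 m i l) (hW0 l j))
    ⟨k, Finset.mem_univ _, mul_pos hk ((hW0 k j).lt_of_ne' hkj)⟩

lemma influencers_nonempty (hW0 : ∀ i j, 0 ≤ W i j) (hW1 : ∀ i, ∑ j, W i j = 1) (i : ι) :
    (influencers W i).Nonempty := by
  obtain ⟨j, -, hj⟩ := Finset.exists_ne_zero_of_sum_ne_zero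
    (show ∑ j, W i j ≠ 0 by rw [hW1 i]; exact one_ne_zero)
  exact ⟨j, 1, le_rfl, by rw [pow_one]; exact (hW0 i j).lt_of_ne' hj⟩

lemma InClosed.mem_of_pow_ne_zero {S : Set ι} (hS : InClosed W S) {i : ι} (hi : i ∈ S) (m : ℕ)
    {j : ι} (h : (W ^ m) i j ≠ 0) : j ∈ S := by
  induction m generalizing j with
  | zero =>
    rw [pow_zero, Matrix.one_apply] at h
    split_ifs at h with hij
    · exact hij ▸ hi
    · exact absurd rfl h
  | succ m ih =>
    rw [pow_succ, Matrix.mul_apply] at h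
    obtain ⟨k, -, hk⟩ := Finset.exists_ne_zero_of_sum_ne_zero h
    exact hS k (ih (left_ne_zero_of_mul hk)) j (right_ne_zero_of_mul hk)

lemma InClosed.influencers_subset {S : Set ι} (hS : InClosed W S) {i : ι} (hi : i ∈ S) :
    influencers W i ⊆ S :=
  fun _ ⟨m, _, h⟩ => hS.mem_of_pow_ne_zero hi m h.ne'

omit [DecidableEq ι] in
lemma InClosed.exists_minimal_subset {C : Set ι} (hC : InClosed W C) (hne : C.Nonempty) :
    ∃ S ⊆ C, Minimal (fun S => S.Nonempty ∧ InClosed W S) S :=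
  exists_minimal_le_of_wellFoundedLT (fun S : Set ι => S.Nonempty ∧ InClosed W S) C ⟨hne, hC⟩

end Graph

section Stubborn

variable {n : ℕ} {W : Matrix (Fin n) (Fin n) ℝ} {ξ : Fin n → ℝ}

lemma isISCC_of_minimal (hW0 : ∀ i j, 0 ≤ W i j) (hW1 : ∀ i, ∑ j, W i j = 1) {S : Set (Fin n)}
    (hS : Minimal (fun S => S.Nonempty ∧ InClosed W S) S) : IsISCC W S :=
  ⟨hS.prop.1, hS.prop.2, fun i hi _ hj _ =>
    hS.le_of_le ⟨influencers_nonempty hW0 hW1 i, inClosed_influencers hW0 i⟩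
      (hS.prop.2.influencers_subset hi) hj⟩

lemma Assumption2.exists_stubborn (hA2 : Assumption2 W ξ) (hW0 : ∀ i j, 0 ≤ W i j)
    (hW1 : ∀ i, ∑ j, W i j = 1) {C : Set (Fin n)} (hC : InClosed W C) (hne : C.Nonempty) :
    ∃ i ∈ C, ξ i < 1 := by
  obtain ⟨S, hSC, hS⟩ := hC.exists_minimal_subset hne
  obtain ⟨i, hi, h⟩ := hA2 S (isISCC_of_minimal hW0 hW1 hS)
  exact ⟨i, hSC hi, h⟩

/-- Minimum principle for the equilibrium equation `y = Ξ W y + (I - Ξ) x` on an in-closed set. -/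
lemma Assumption2.nonneg_of_equilibrium (hA2 : Assumption2 W ξ) (hW0 : ∀ i j, 0 ≤ W i j)
    (hW1 : ∀ i, ∑ j, W i j = 1) (hξ : ∀ i, 0 ≤ ξ i ∧ ξ i ≤ 1) {C : Set (Fin n)}
    (hC : InClosed W C) {x y : Fin n → ℝ} (hx : ∀ i ∈ C, 0 ≤ x i)
    (hy : ∀ i ∈ C, y i = ξ i * (W *ᵥ y) i + (1 - ξ i) * x i) : ∀ i ∈ C, 0 ≤ y i := by
  by_contra! ⟨k, hk, hyk⟩
  obtain ⟨p, hpC, hp⟩ := Set.exists_min_image C y C.toFinite ⟨k, hk⟩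
  have hneg : y p < 0 := (hp k hk).trans_lt hyk
  have hterm : ∀ i ∈ C, ∀ j, 0 ≤ W i j * (y j - y p) := fun i hi j => by
    by_cases h : W i j = 0
    · simp [h]
    · exact mul_nonneg (hW0 i j) (sub_nonneg.2 (hp j (hC i hi j h)))
  have hsum : ∀ i, (W *ᵥ y) i - y p = ∑ j, W i j * (y j - y p) := fun i => by
    simp only [mul_sub, Finset.sum_sub_distrib, ← Finset.sum_mul, hW1, one_mul]
    rfl
  have hmean : ∀ i ∈ C, y i = y p → ξ i = 1 ∧ (W *ᵥ y) i = y p := fun i hi h => by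
    have h1 : y p ≤ (W *ᵥ y) i :=
      sub_nonneg.1 (hsum i ▸ Finset.sum_nonneg fun j _ => hterm i hi j)
    have h2 := hy i hi
    rw [h] at h2
    have h3 : ξ i = 1 := by
      by_contra hne
      have h4 : 0 < 1 - ξ i := sub_pos.2 ((hξ i).2.lt_of_ne hne)
      nlinarith [mul_nonneg (hξ i).1 (sub_nonneg.2 h1), mul_nonneg h4.le (hx i hi),
        mul_neg_of_pos_of_neg h4 hneg]
    rw [h3] at h2
    exact ⟨h3, by linarith⟩
  obtain ⟨i, ⟨hi, hiy⟩, h⟩ := hA2.exists_stubborn hW0 hW1 (C := {i | i ∈ C ∧ y i = y p})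
    (fun i ⟨hi, hiy⟩ j hij => by
      refine ⟨hC i hi j hij, ?_⟩
      have h0 := hsum i
      rw [(hmean i hi hiy).2, sub_self, eq_comm,
        Finset.sum_eq_zero_iff_of_nonneg fun j _ => hterm i hi j] at h0
      exact sub_eq_zero.1 ((mul_eq_zero.1 (h0 j (Finset.mem_univ j))).resolve_left hij))
    ⟨p, hpC, rfl⟩
  exact h.ne (hmean i hi hiy).1

/-- An initial opinion that is constant on an in-closed set remains so at equilibrium. -/
lemma Assumption2.eq_const_of_equilibrium (hA2 : Assumption2 W ξ) (hW0 : ∀ i j, 0 ≤ W i j)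
    (hW1 : ∀ i, ∑ j, W i j = 1) (hξ : ∀ i, 0 ≤ ξ i ∧ ξ i ≤ 1) {C : Set (Fin n)}
    (hC : InClosed W C) {x y : Fin n → ℝ} {c : ℝ} (hx : ∀ i ∈ C, x i = c)
    (hy : ∀ i ∈ C, y i = ξ i * (W *ᵥ y) i + (1 - ξ i) * x i) : ∀ i ∈ C, y i = c := by
  have hsub : ∀ i, (W *ᵥ fun j => y j - c) i = (W *ᵥ y) i - c := fun i => by
    simp only [Matrix.mulVec, dotProduct, mul_sub, Finset.sum_sub_distrib, ← Finset.sum_mul, hW1,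
      one_mul]
  have hsub' : ∀ i, (W *ᵥ fun j => c - y j) i = c - (W *ᵥ y) i := fun i => by
    simp only [Matrix.mulVec, dotProduct, mul_sub, Finset.sum_sub_distrib, ← Finset.sum_mul, hW1,
      one_mul]
  have h1 := hA2.nonneg_of_equilibrium hW0 hW1 hξ hC (x := 0) (y := fun j => y j - c)
    (fun _ _ => le_rfl) fun i hi => by
      rw [hsub, hy i hi, hx i hi, Pi.zero_apply]; ring
  have h2 := hA2.nonneg_of_equilibrium hW0 hW1 hξ hC (x := 0) (y := fun j => c - y j)
    (fun _ _ => le_rfl) fun i hi => by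
      rw [hsub', hy i hi, hx i hi, Pi.zero_apply]; ring
  intro i hi
  linarith [h1 i hi, h2 i hi]

lemma one_sub_diagonal_mul_mulVec (y : Fin n → ℝ) (i : Fin n) :
    ((1 - Matrix.diagonal ξ * W) *ᵥ y) i = y i - ξ i * (W *ᵥ y) i := by
  rw [Matrix.sub_mulVec, Matrix.one_mulVec, ← Matrix.mulVec_mulVec, Pi.sub_apply,
    Matrix.mulVec_diagonal]

lemma Assumption2.isUnit_one_sub (hA2 : Assumption2 W ξ) (hW0 : ∀ i j, 0 ≤ W i j)
    (hW1 : ∀ i, ∑ j, W i j = 1) (hξ : ∀ i, 0 ≤ ξ i ∧ ξ i ≤ 1) :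
    IsUnit (1 - Matrix.diagonal ξ * W) := by
  rw [← Matrix.mulVec_injective_iff_isUnit]
  refine (injective_iff_map_eq_zero (Matrix.mulVecLin (1 - Matrix.diagonal ξ * W))).2
    fun y hy => funext fun i => ?_
  refine hA2.eq_const_of_equilibrium hW0 hW1 hξ (C := Set.univ) (fun _ _ _ _ => Set.mem_univ _)
    (x := 0) (fun _ _ => rfl) (fun k _ => ?_) i (Set.mem_univ i)
  have h := congrFun hy k
  rw [Matrix.mulVecLin_apply, one_sub_diagonal_mul_mulVec, Pi.zero_apply] at h
  rw [Pi.zero_apply, mul_zero, add_zero]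
  exact sub_eq_zero.1 h

lemma Assumption2.equilibrium (hA2 : Assumption2 W ξ) (hW0 : ∀ i j, 0 ≤ W i j)
    (hW1 : ∀ i, ∑ j, W i j = 1) (hξ : ∀ i, 0 ≤ ξ i ∧ ξ i ≤ 1) (x : Fin n → ℝ) (i : Fin n) :
    let y := ((1 - Matrix.diagonal ξ * W)⁻¹ * (1 - Matrix.diagonal ξ)) *ᵥ x
    y i = ξ i * (W *ᵥ y) i + (1 - ξ i) * x i := by
  intro y
  have h : (1 - Matrix.diagonal ξ * W) *ᵥ y = (1 - Matrix.diagonal ξ) *ᵥ x := by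
    rw [Matrix.mulVec_mulVec, Matrix.mul_nonsing_inv_cancel_left _ _
      ((Matrix.isUnit_iff_isUnit_det _).1 (hA2.isUnit_one_sub hW0 hW1 hξ))]
  have hi := congrFun h i
  rw [one_sub_diagonal_mul_mulVec, Matrix.sub_mulVec, Matrix.one_mulVec, Pi.sub_apply,
    Matrix.mulVec_diagonal] at hi
  linarith

end Stubborn

/-- A row-stochastic matrix contracts the range of a vector when one of its columns is
bounded below by `ε`. -/
lemma mulVec_mem_Icc_of_column {ι : Type*} [Fintype ι] {P : Matrix ι ι ℝ}
    (hP0 : ∀ i j, 0 ≤ P i j) (hP1 : ∀ i, ∑ j, P i j = 1) {p : ι} {ε : ℝ}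
    (hε : ∀ l, ε ≤ P l p) {x : ι → ℝ} {a b : ℝ} (hx : ∀ j, x j ∈ Set.Icc a b) (l : ι) :
    (P *ᵥ x) l ∈ Set.Icc (a + ε * (x p - a)) (b - ε * (b - x p)) := by
  have h1 : P l p * (x p - a) ≤ ∑ j, P l j * (x j - a) :=
    Finset.single_le_sum (f := fun j => P l j * (x j - a))
      (fun j _ => mul_nonneg (hP0 l j) (sub_nonneg.2 (hx j).1)) (Finset.mem_univ p)
  have h2 : P l p * (b - x p) ≤ ∑ j, P l j * (b - x j) :=
    Finset.single_le_sum (f := fun j => P l j * (b - x j))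
      (fun j _ => mul_nonneg (hP0 l j) (sub_nonneg.2 (hx j).2)) (Finset.mem_univ p)
  simp only [mul_sub (P l _), Finset.sum_sub_distrib, ← Finset.sum_mul, hP1, one_mul] at h1 h2
  have h3 := mul_le_mul_of_nonneg_right (hε l) (sub_nonneg.2 (hx p).1)
  have h4 := mul_le_mul_of_nonneg_right (hε l) (sub_nonneg.2 (hx p).2)
  simp only [Matrix.mulVec, dotProduct]
  constructor <;> linarith

lemma exists_tendsto_pow_mulVec_of_column_pos {ι : Type*} [Fintype ι] [DecidableEq ι]
    {P : Matrix ι ι ℝ} (hP0 : ∀ i j, 0 ≤ P i j) (hP1 : ∀ i, ∑ j, P i j = 1) {p : ι}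
    (hp : ∀ l, 0 < P l p) (x : ι → ℝ) :
    ∃ χ : ℝ, ∀ l, Tendsto (fun s => ((P ^ s) *ᵥ x) l) atTop (nhds χ) := by
  have : Nonempty ι := ⟨p⟩
  obtain ⟨q, hq⟩ := Finite.exists_min fun l => P l p
  set ε := P q p
  have hε0 : 0 < ε := hp q
  have hε1 : ε ≤ 1 := hP1 q ▸ Finset.single_le_sum (fun j _ => hP0 q j) (Finset.mem_univ p)
  obtain ⟨u, hu⟩ := Finite.exists_min x
  obtain ⟨v, hv⟩ := Finite.exists_max x
  set K := x v - x u
  have hrange : ∀ s, ∃ a b, b - a = K * (1 - ε) ^ s ∧ ∀ l, ((P ^ s) *ᵥ x) l ∈ Set.Icc a b := by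
    intro s
    induction s with
    | zero => exact ⟨x u, x v, by simp [K], fun l => by simpa using ⟨hu l, hv l⟩⟩
    | succ s ih =>
      obtain ⟨a, b, hab, h⟩ := ih
      set c := ((P ^ s) *ᵥ x) p
      refine ⟨a + ε * (c - a), b - ε * (b - c), ?_, fun l => ?_⟩
      · rw [pow_succ, ← mul_assoc, ← hab]; ring
      · rw [pow_succ', ← Matrix.mulVec_mulVec]
        exact mulVec_mem_Icc_of_column hP0 hP1 hq h l
  have hclose : ∀ s l, |((P ^ s) *ᵥ x) l - ((P ^ s) *ᵥ x) p| ≤ K * (1 - ε) ^ s := fun s l => by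
    obtain ⟨a, b, hab, h⟩ := hrange s
    rw [← hab, abs_sub_le_iff]
    constructor <;> linarith [(h l).1, (h l).2, (h p).1, (h p).2]
  have hstep : ∀ s, dist (((P ^ s) *ᵥ x) p) (((P ^ (s + 1)) *ᵥ x) p) ≤ K * (1 - ε) ^ s :=
    fun s => by
    obtain ⟨a, b, hab, h⟩ := hrange s
    have h' := mulVec_mem_Icc_of_column hP0 hP1 (p := p) (ε := 0) (fun l => hP0 l p) h p
    rw [Matrix.mulVec_mulVec, ← pow_succ'] at h'
    rw [← hab, Real.dist_eq, abs_sub_le_iff]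
    constructor <;> linarith [h'.1, h'.2, (h p).1, (h p).2]
  obtain ⟨χ, hχ⟩ := cauchySeq_tendsto_of_complete
    (cauchySeq_of_le_geometric (1 - ε) K (by linarith) hstep)
  have hgeom : Tendsto (fun s => K * (1 - ε) ^ s) atTop (nhds 0) := by
    simpa using (tendsto_pow_atTop_nhds_zero_of_lt_one (sub_nonneg.2 hε1)
      (sub_lt_self 1 hε0)).const_mul K
  refine ⟨χ, fun l => ?_⟩
  simpa using (squeeze_zero_norm (fun s => hclose s l) hgeom).add hχ

/-- Theorem 2: with no fully stubborn agents and Assumption 2, the issue-sequence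
dynamics `x(s+1) = Ψ x(s)` achieves opinion consensus iff there is a partially
stubborn agent with directed paths in `G(W)` to every other partially stubborn
agent. -/
theorem issue_sequence_consensus_iff
    (n : ℕ) (hn : 1 ≤ n)
    (W Ξ : Matrix (Fin n) (Fin n) ℝ) (ξ : Fin n → ℝ)
    (hW0 : ∀ i j, 0 ≤ W i j) (hW1 : ∀ i, ∑ j, W i j = 1)
    (hΞ : Ξ = Matrix.diagonal ξ) (hξ : ∀ i, 0 ≤ ξ i ∧ ξ i ≤ 1)
    (hVf : ∀ i, 0 < ξ i)
    (hA2 : Assumption2 W ξ)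
    (Ψ : Matrix (Fin n) (Fin n) ℝ) (hΨ : Ψ = (1 - Ξ * W)⁻¹ * (1 - Ξ)) :
    (∀ x0 : Fin n → ℝ, ∃ χ : ℝ, ∀ l,
        Tendsto (fun s => (Ψ ^ s).mulVec x0 l) atTop (nhds χ))
    ↔ (∃ i, 0 < ξ i ∧ ξ i < 1 ∧
        ∀ j, 0 < ξ j → ξ j < 1 → j ≠ i → ∃ m, 1 ≤ m ∧ 0 < (W ^ m) j i) := by
  subst hΞ
  have heq : ∀ (x : Fin n → ℝ) (i : Fin n),
      (Ψ *ᵥ x) i = ξ i * (W *ᵥ (Ψ *ᵥ x)) i + (1 - ξ i) * x i := by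
    subst hΨ
    exact hA2.equilibrium hW0 hW1 hξ
  have huniv : InClosed W Set.univ := fun _ _ _ _ => Set.mem_univ _
  constructor
  · intro hcons
    obtain ⟨S, -, hS⟩ := huniv.exists_minimal_subset ⟨⟨0, hn⟩, Set.mem_univ _⟩
    obtain ⟨i, hiS, hi⟩ := hA2.exists_stubborn hW0 hW1 hS.prop.2 hS.prop.1
    refine ⟨i, hVf i, hi, fun j _ _ _ => ?_⟩
    by_contra hij
    have hdisj : ∀ k ∈ influencers W j, k ∉ S := fun k hkj hkS =>
      hij (hS.le_of_le (y := S ∩ influencers W j)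
        ⟨⟨k, hkS, hkj⟩, fun a ha b hab =>
          ⟨hS.prop.2 a ha.1 b hab, inClosed_influencers hW0 j a ha.2 b hab⟩⟩
        Set.inter_subset_left hiS).2
    have hconst : ∀ (C : Set (Fin n)) (x : Fin n → ℝ) (c : ℝ), InClosed W C → (∀ k ∈ C, x k = c) →
        ∀ s, ∀ k ∈ C, ((Ψ ^ s) *ᵥ x) k = c := by
      intro C x c hC hx s
      induction s with
      | zero => simpa using hx
      | succ s ih =>
        rw [pow_succ', ← Matrix.mulVec_mulVec]
        exact hA2.eq_const_of_equilibrium hW0 hW1 hξ hC ih fun k _ => heq _ k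
    obtain ⟨k, hk⟩ := influencers_nonempty hW0 hW1 j
    obtain ⟨χ, hχ⟩ := hcons (S.indicator 1)
    have h1 := hχ i
    have h0 := hχ k
    simp only [hconst S (S.indicator 1) 1 hS.prop.2
      (fun l hl => Set.indicator_of_mem hl _) _ i hiS] at h1
    simp only [hconst (influencers W j) (S.indicator 1) 0 (inClosed_influencers hW0 j)
      (fun l hl => Set.indicator_of_notMem (hdisj l hl) _) _ k hk] at h0
    exact one_ne_zero ((tendsto_nhds_unique tendsto_const_nhds h1).trans
      (tendsto_nhds_unique tendsto_const_nhds h0).symm)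
  · rintro ⟨p, -, hp, hreach⟩
    have hcol : ∀ i j, (Ψ *ᵥ Pi.single j 1) i = Ψ i j := fun i j => by simp
    have hΨ0 : ∀ i j, 0 ≤ Ψ i j := fun i j => by
      rw [← hcol]
      exact hA2.nonneg_of_equilibrium hW0 hW1 hξ huniv (x := Pi.single j 1)
        (fun k _ => (Pi.single_nonneg.2 zero_le_one : (0 : Fin n → ℝ) ≤ Pi.single j 1) k)
        (fun k _ => heq _ k) i (Set.mem_univ i)
    have hΨ1 : ∀ i, ∑ j, Ψ i j = 1 := fun i => by
      have h := hA2.eq_const_of_equilibrium hW0 hW1 hξ huniv (x := 1) (c := 1)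
        (fun _ _ => rfl) (fun k _ => heq 1 k) i (Set.mem_univ i)
      simpa [Matrix.mulVec, dotProduct] using h
    have hpcol : ∀ l, Ψ l p = ξ l * ∑ k, W l k * Ψ k p + (1 - ξ l) * (Pi.single p 1 : Fin n → ℝ) l :=
      fun l => by
      have h := heq (Pi.single p 1) l
      rw [hcol] at h
      rwa [funext fun k => hcol k p] at h
    have hterm : ∀ l k, 0 ≤ W l k * Ψ k p := fun l k => mul_nonneg (hW0 l k) (hΨ0 k p)
    have hpp : 0 < Ψ p p := by
      rw [hpcol p, Pi.single_eq_same, mul_one]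
      exact add_pos_of_nonneg_of_pos
        (mul_nonneg (hξ p).1 (Finset.sum_nonneg fun k _ => hterm p k)) (sub_pos.2 hp)
    have hzero : InClosed W {l | Ψ l p = 0} := fun l hl k hlk => by
      have hl : Ψ l p = 0 := hl
      have hlp : l ≠ p := fun h => hpp.ne' (h ▸ hl)
      have h := hpcol l
      rw [hl, Pi.single_eq_of_ne hlp, mul_zero, add_zero, eq_comm, mul_eq_zero,
        or_iff_right (hVf l).ne', Finset.sum_eq_zero_iff_of_nonneg fun k _ => hterm l k] at h
      exact (mul_eq_zero.1 (h k (Finset.mem_univ k))).resolve_left hlk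
    refine exists_tendsto_pow_mulVec_of_column_pos hΨ0 hΨ1 (p := p) fun l =>
      (hΨ0 l p).lt_of_ne' fun hl => ?_
    obtain ⟨j, hj, hj1⟩ := hA2.exists_stubborn hW0 hW1 hzero ⟨l, hl⟩
    obtain ⟨m, -, hm⟩ := hreach j (hVf j) hj1 fun h => hpp.ne' (h ▸ hj)
    exact hpp.ne' (hzero.mem_of_pow_ne_zero hj m hm.ne')
end
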